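/- (Weighted Bernstein inequality, high-frequency part) Let n ≥ 1, s > 0, p ∈ [1,∞], and a ≥ 0. Then there exists C > 0, depending only on n, a, s, p and Φ, such that for every k ∈ ℕ and every f ∈ 𝒮(ℝⁿ): ‖f − S_k f‖_{L^p_{⟨x⟩^a}} ≤ C 2^{−ks} ‖J^s f‖_{L^p_{⟨x⟩^a}}. -/

import Mathlib

open MeasureTheory Real Complex
open scoped ENNReal NNReal RealInnerProductSpace

noncomputable section

abbrev Eu (n : ℕ) := EuclideanSpace ℝ (Fin n)

/-- The polynomial weight `⟨x⟩^a = (1+|x|²)^{a/2}` as an `ℝ≥0∞`-valued function. -/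
def jweight {n : ℕ} (a : ℝ) (x : Eu n) : ℝ≥0∞ :=
  ENNReal.ofReal ((1 + ‖x‖ ^ 2) ^ (a / 2))

/-- Weighted Lebesgue (quasi-)norm `‖f‖_{L^p_{⟨x⟩^a}}`; for `p = ∞` the essential sup norm. -/
def wNorm {n : ℕ} {F : Type*} [NormedAddCommGroup F] (p : ℝ≥0∞) (a : ℝ)
    (f : Eu n → F) : ℝ≥0∞ :=
  if p = ∞ then essSup (fun x => (‖f x‖₊ : ℝ≥0∞)) volume
  else (∫⁻ x, (‖f x‖₊ : ℝ≥0∞) ^ p.toReal * jweight a x) ^ (1 / p.toReal)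

/-- The Fourier transform `f̂(ξ) = ∫ f(x) e^{-i x·ξ} dx`. -/
def FT {n : ℕ} (f : Eu n → ℂ) (ξ : Eu n) : ℂ :=
  ∫ x, f x * Complex.exp (-(Complex.I * ((⟪x, ξ⟫ : ℝ) : ℂ)))

/-- The inhomogeneous fractional derivative (Bessel potential) `J^s`. -/
def Js {n : ℕ} (s : ℝ) (f : Eu n → ℂ) (x : Eu n) : ℂ :=
  ((((2 * Real.pi) ^ n)⁻¹ : ℝ) : ℂ) *
    ∫ ξ, (((1 + ‖ξ‖ ^ 2) ^ (s / 2) : ℝ) : ℂ) * FT f ξ *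
      Complex.exp (Complex.I * ((⟪x, ξ⟫ : ℝ) : ℂ))

/-- A Littlewood–Paley bump: `Φ ∈ C_c^∞(ℝⁿ)` with `0 ≤ Φ ≤ 1`, `Φ = 1` on `|ξ| ≤ 1` and
`Φ = 0` on `|ξ| ≥ 2`. -/
def IsLPBump {n : ℕ} (Φ : Eu n → ℝ) : Prop :=
  ContDiff ℝ (⊤ : ℕ∞) Φ ∧ (∀ ξ, 0 ≤ Φ ξ ∧ Φ ξ ≤ 1) ∧
    (∀ ξ, ‖ξ‖ ≤ 1 → Φ ξ = 1) ∧ (∀ ξ, 2 ≤ ‖ξ‖ → Φ ξ = 0)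

/-- The low-frequency projection `S_k f`, with Fourier multiplier `Φ(2^{-k}ξ)`. -/
def SProj {n : ℕ} (Φ : Eu n → ℝ) (k : ℤ) (f : Eu n → ℂ) (x : Eu n) : ℂ :=
  ((((2 * Real.pi) ^ n)⁻¹ : ℝ) : ℂ) *
    ∫ ξ, ((Φ ((2 : ℝ) ^ (-k) • ξ) : ℝ) : ℂ) * FT f ξ *
      Complex.exp (Complex.I * ((⟪x, ξ⟫ : ℝ) : ℂ))

/-- The Littlewood–Paley piece `Δ_k f = S_k f - S_{k-1} f`, with Fourier multiplier
`Ψ(2^{-k}ξ) = Φ(2^{-k}ξ) - Φ(2^{-(k-1)}ξ)`. -/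
def DProj {n : ℕ} (Φ : Eu n → ℝ) (k : ℤ) (f : Eu n → ℂ) (x : Eu n) : ℂ :=
  SProj Φ k f x - SProj Φ (k - 1) f x

open scoped FourierTransform ContDiff SchwartzMap

lemma exists_slice {n : ℕ} (H : 𝓢(ℝ × Eu n, ℂ)) (t : ℝ) :
    ∃ h : 𝓢(Eu n, ℂ), (∀ η, h η = H (t, η)) ∧
      ∀ k m : ℕ, SchwartzMap.seminorm ℝ k m h ≤ SchwartzMap.seminorm ℝ k m H := by
  have key : ∀ k m : ℕ, ∀ η : Eu n, ‖η‖ ^ k * ‖iteratedFDeriv ℝ m (fun η => H (t, η)) η‖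
      ≤ SchwartzMap.seminorm ℝ k m H := by
    intro k m η
    have e : (fun η : Eu n => H (t, η)) =
        (fun z => H (((t, 0) : ℝ × Eu n) + z)) ∘ (ContinuousLinearMap.inr ℝ ℝ (Eu n)) := by
      funext η; simp
    have hs : ContDiff ℝ m (fun z => H (((t, 0) : ℝ × Eu n) + z)) :=
      ((H.smooth m).comp (contDiff_const.add contDiff_id))
    rw [e, ContinuousLinearMap.iteratedFDeriv_comp_right _ hs _ le_rfl,
      iteratedFDeriv_comp_add_left]
    refine le_trans ?_ (SchwartzMap.le_seminorm ℝ k m H (t, η))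
    have h1 : ‖η‖ ≤ ‖((t, η) : ℝ × Eu n)‖ := le_max_right _ _
    gcongr
    refine (ContinuousMultilinearMap.norm_compContinuousLinearMap_le _ _).trans ?_
    have h2 : ∏ i : Fin m, ‖(ContinuousLinearMap.inr ℝ ℝ (Eu n))‖ ≤ 1 := by
      apply Finset.prod_le_one
      · intros; positivity
      · intros; exact ContinuousLinearMap.norm_inr_le_one ℝ ℝ (Eu n)
    refine (mul_le_of_le_one_right (norm_nonneg _) h2).trans ?_
    simp
  refine ⟨⟨fun η => H (t, η), ?_, fun k m => ⟨_, key k m⟩⟩, fun η => rfl, ?_⟩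
  · exact (H.smooth ⊤).comp (contDiff_const.prodMk contDiff_id)
  · intro k m
    exact SchwartzMap.seminorm_le_bound ℝ k m _ (apply_nonneg _ _) (key k m)

lemma exists_H {n : ℕ} (s : ℝ) (ψ : Eu n → ℝ) (hψ : ContDiff ℝ ∞ ψ)
    (h0 : ∀ ξ, ‖ξ‖ ≤ 1 / 2 → ψ ξ = 0) (h2 : ∀ ξ, 2 ≤ ‖ξ‖ → ψ ξ = 0) :
    ∃ H : 𝓢(ℝ × Eu n, ℂ), ∀ t η, 0 ≤ t → t ≤ 1 → H (t, η) =
      ((ψ ((2 * π) • η) * (t ^ 2 + ‖(2 * π) • η‖ ^ 2) ^ (-s / 2) : ℝ) : ℂ) := by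
  let χ : ContDiffBump (0 : ℝ) := ⟨1, 2, by norm_num, by norm_num⟩
  let G : ℝ × Eu n → ℝ := fun z => χ z.1 *
    (ψ ((2 * π) • z.2) * (z.1 ^ 2 + ‖(2 * π) • z.2‖ ^ 2) ^ (-s / 2))
  have hn : ∀ η : Eu n, ‖(2 * π) • η‖ = 2 * π * ‖η‖ := fun η => by
    rw [norm_smul, Real.norm_of_nonneg (by positivity)]
  have hG : ContDiff ℝ ∞ G := by
    rw [contDiff_iff_contDiffAt]
    rintro ⟨t, η⟩
    have hc : ContDiff ℝ ∞ (fun z : ℝ × Eu n => (2 * π) • z.2) := by fun_prop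
    have hp : ContDiff ℝ ∞ (fun z : ℝ × Eu n => ψ ((2 * π) • z.2)) := hψ.comp hc
    have hx : ContDiff ℝ ∞ (fun z : ℝ × Eu n => χ z.1) := χ.contDiff.comp contDiff_fst
    by_cases hη : η = 0
    · subst hη
      have : G =ᶠ[nhds (t, 0)] fun _ => 0 := by
        have ho : IsOpen {z : ℝ × Eu n | ‖(2 * π) • z.2‖ < 1 / 2} :=
          isOpen_lt (by fun_prop) continuous_const
        filter_upwards [ho.mem_nhds (by simp)] with z hz
        simp only [G, h0 _ (le_of_lt hz)]
        simp
      exact contDiffAt_const.congr_of_eventuallyEq this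
    · refine hx.contDiffAt.mul (hp.contDiffAt.mul ?_)
      have hq : ContDiff ℝ ∞ (fun z : ℝ × Eu n => z.1 ^ 2 + ‖(2 * π) • z.2‖ ^ 2) :=
        (contDiff_fst.pow 2).add (hc.norm_sq ℝ)
      refine hq.contDiffAt.rpow_const_of_ne ?_
      have : 0 < ‖η‖ := norm_pos_iff.2 hη
      simp only [hn]
      positivity
  have hGs : HasCompactSupport G := by
    refine HasCompactSupport.intro
      ((isCompact_closedBall (0 : ℝ) 2).prod (isCompact_closedBall (0 : Eu n) 2)) ?_
    rintro ⟨t, η⟩ hz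
    simp only [Set.mem_prod, Metric.mem_closedBall, dist_zero_right, not_and_or, not_le] at hz
    rcases hz with hz | hz
    · have : χ t = 0 := χ.zero_of_le_dist (by simpa [χ] using hz.le)
      simp [G, this]
    · have : ψ ((2 * π) • η) = 0 := by
        apply h2
        rw [hn]
        nlinarith [Real.pi_gt_three, norm_nonneg η]
      simp [G, this]
  refine ⟨HasCompactSupport.toSchwartzMap (f := fun z => ((G z : ℝ) : ℂ))
    (hGs.comp_left (g := fun x : ℝ => (x : ℂ)) (by simp))
    (Complex.ofRealCLM.contDiff.comp hG), ?_⟩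
  intro t η ht0 ht1
  have : χ t = 1 := χ.one_of_mem_closedBall (by simp [χ, abs_of_nonneg ht0, ht1])
  simp [G, this]

lemma exists_h {n : ℕ} (s : ℝ) (N : ℕ) (ψ : Eu n → ℝ) (hψ : ContDiff ℝ ∞ ψ)
    (h0 : ∀ ξ, ‖ξ‖ ≤ 1 / 2 → ψ ξ = 0) (h2 : ∀ ξ, 2 ≤ ‖ξ‖ → ψ ξ = 0) :
    ∃ C : ℝ, 0 ≤ C ∧ ∀ t, 0 ≤ t → t ≤ 1 → ∃ h : 𝓢(Eu n, ℂ),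
      (∀ η, h η = ((ψ ((2 * π) • η) * (t ^ 2 + ‖(2 * π) • η‖ ^ 2) ^ (-s / 2) : ℝ) : ℂ)) ∧
      ∀ x, (1 + ‖x‖) ^ N * ‖(𝓕⁻ h) x‖ ≤ C := by
  obtain ⟨H, hH⟩ := exists_H s ψ hψ h0 h2
  let q : Seminorm ℝ 𝓢(Eu n, ℂ) :=
    ((Finset.Iic ((N, 0) : ℕ × ℕ)).sup (fun m => SchwartzMap.seminorm ℝ m.1 m.2)).comp
      (FourierTransform.fourierInvCLM ℝ 𝓢(Eu n, ℂ)).toLinearMap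
  have hq : Continuous q := by
    have h1 : Continuous ((Finset.Iic ((N, 0) : ℕ × ℕ)).sup
        (fun m => SchwartzMap.seminorm ℝ m.1 m.2) : Seminorm ℝ 𝓢(Eu n, ℂ)) := by
      refine Seminorm.continuous_finsetSup ?_
      intro i _
      exact (schwartz_withSeminorms ℝ (Eu n) ℂ).continuous_seminorm i
    exact h1.comp (FourierTransform.fourierInvCLM ℝ 𝓢(Eu n, ℂ)).continuous
  obtain ⟨S, C, -, hC⟩ := Seminorm.bound_of_continuous (schwartz_withSeminorms ℝ (Eu n) ℂ) q hq
  refine ⟨2 ^ N * (C * S.sup (schwartzSeminormFamily ℝ (ℝ × Eu n) ℂ) H), by positivity, ?_⟩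
  intro t ht0 ht1
  obtain ⟨h, hh, hb⟩ := exists_slice H t
  refine ⟨h, fun η => by rw [hh, hH t η ht0 ht1], fun x => ?_⟩
  have h3 := SchwartzMap.one_add_le_sup_seminorm_apply (𝕜 := ℝ) (m := (N, 0)) (k := N) (n := 0)
    le_rfl le_rfl (𝓕⁻ h) x
  rw [norm_iteratedFDeriv_zero] at h3
  refine h3.trans ?_
  simp only
  gcongr
  refine (hC h).trans ?_
  rw [smul_apply, NNReal.smul_def, smul_eq_mul]
  gcongr
  refine Seminorm.finset_sup_apply_le (apply_nonneg _ _) ?_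
  intro i hi
  refine (hb i.1 i.2).trans ?_
  exact Seminorm.le_finset_sup_apply (p := schwartzSeminormFamily ℝ (ℝ × Eu n) ℂ) hi

lemma jensen_aux {α : Type*} [MeasurableSpace α] (μ : Measure α) (k G : α → ℝ≥0∞)
    (hk : Measurable k) (hG : Measurable G) (r : ℝ) (hr : 1 ≤ r) :
    (∫⁻ y, k y * G y ∂μ) ^ r ≤ (∫⁻ y, k y ∂μ) ^ (r - 1) * ∫⁻ y, k y * G y ^ r ∂μ := by
  have hr0 : 0 < r := by linarith
  have h1 : 0 ≤ 1 - 1 / r := by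
    rw [sub_nonneg, div_le_one hr0]; exact hr
  have h2 : 0 ≤ 1 / r := by positivity
  have h := ENNReal.lintegral_mul_norm_pow_le (μ := μ) (f := k) (g := fun y => k y * G y ^ r)
    hk.aemeasurable (by fun_prop) h1 h2 (by ring)
  have e : ∀ y, k y ^ (1 - 1 / r) * (k y * G y ^ r) ^ (1 / r) = k y * G y := by
    intro y
    rw [ENNReal.mul_rpow_of_nonneg _ _ h2, ← mul_assoc, ← ENNReal.rpow_add_of_nonneg _ _ h1 h2,
      ← ENNReal.rpow_mul]
    have : r * (1 / r) = 1 := by field_simp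
    rw [this]; simp
  simp only [e] at h
  calc _ ≤ _ := ENNReal.rpow_le_rpow h hr0.le
    _ = _ := by
      rw [ENNReal.mul_rpow_of_nonneg _ _ hr0.le, ← ENNReal.rpow_mul, ← ENNReal.rpow_mul]
      congr 2
      · field_simp
      · have : 1 / r * r = 1 := by field_simp
        rw [this]; simp

lemma young_aux {n : ℕ} (k G w : Eu n → ℝ≥0∞) (hk : Measurable k) (hG : Measurable G)
    (hw : Measurable w) (A : ℝ≥0∞) (hw1 : ∀ x, 1 ≤ w x)
    (hA : ∀ x y, w x ≤ A * (w y * w (x - y))) (r : ℝ) (hr : 1 ≤ r) :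
    ∫⁻ x, (∫⁻ y, k y * G (x - y)) ^ r * w x ≤
      A * (∫⁻ y, k y * w y) ^ r * ∫⁻ x, G x ^ r * w x := by
  set I := ∫⁻ y, k y * w y with hI
  have hkI : ∫⁻ y, k y ≤ I := lintegral_mono fun y => le_mul_of_one_le_right' (hw1 y)
  have hm : Measurable (fun z : Eu n × Eu n => k z.2 * G (z.1 - z.2) ^ r * w z.1) := by fun_prop
  calc _ ≤ ∫⁻ x, I ^ (r - 1) * (A * ∫⁻ y, k y * w y * (G (x - y) ^ r * w (x - y))) := by
        refine lintegral_mono fun x => ?_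
        calc _ ≤ ((∫⁻ y, k y) ^ (r - 1) * ∫⁻ y, k y * G (x - y) ^ r) * w x := by
              gcongr
              exact jensen_aux volume k (fun y => G (x - y)) hk (by fun_prop) r hr
          _ ≤ (I ^ (r - 1) * ∫⁻ y, k y * G (x - y) ^ r) * w x := by
              gcongr
          _ = I ^ (r - 1) * ∫⁻ y, k y * G (x - y) ^ r * w x := by
              rw [mul_assoc, lintegral_mul_const _ (by fun_prop)]
          _ ≤ _ := by
              gcongr
              rw [← lintegral_const_mul _ (by fun_prop)]
              refine lintegral_mono fun y => ?_
              calc _ ≤ k y * G (x - y) ^ r * (A * (w y * w (x - y))) := by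
                    gcongr; exact hA x y
                _ = _ := by ring
    _ = I ^ (r - 1) * (A * ∫⁻ x, ∫⁻ y, k y * w y * (G (x - y) ^ r * w (x - y))) := by
        have hm' : Measurable (fun x => ∫⁻ y, k y * w y * (G (x - y) ^ r * w (x - y))) := by
          apply Measurable.lintegral_prod_right'
            (f := fun z : Eu n × Eu n => k z.2 * w z.2 * (G (z.1 - z.2) ^ r * w (z.1 - z.2)))
          fun_prop
        rw [lintegral_const_mul _ (by fun_prop), lintegral_const_mul _ hm']
    _ = I ^ (r - 1) * (A * (I * ∫⁻ x, G x ^ r * w x)) := by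
        congr 2
        rw [lintegral_lintegral_swap (by fun_prop)]
        rw [hI, ← lintegral_mul_const _ (by fun_prop)]
        refine lintegral_congr fun y => ?_
        rw [lintegral_const_mul _ (by fun_prop)]
        congr 1
        exact lintegral_sub_right_eq_self (fun x => G x ^ r * w x) y
    _ = _ := by
        have : I ^ r = I ^ (r - 1) * I := by
          conv_rhs => rw [← ENNReal.rpow_one I, ← ENNReal.rpow_mul]
          rw [← ENNReal.rpow_add_of_nonneg _ _ (by linarith) (by norm_num)]
          congr 1; ring
        rw [this]; ring

lemma jweight_measurable {n : ℕ} (a : ℝ) : Measurable (jweight (n := n) a) := by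
  unfold jweight; fun_prop

lemma one_le_jweight {n : ℕ} (a : ℝ) (ha : 0 ≤ a) (x : Eu n) : 1 ≤ jweight a x := by
  unfold jweight
  rw [ENNReal.one_le_ofReal]
  exact Real.one_le_rpow (by nlinarith [sq_nonneg ‖x‖]) (by positivity)

lemma jweight_le {n : ℕ} (a : ℝ) (ha : 0 ≤ a) (x y : Eu n) :
    jweight a x ≤ ENNReal.ofReal (2 ^ (a / 2)) * (jweight a y * jweight a (x - y)) := by
  unfold jweight
  rw [← ENNReal.ofReal_mul (by positivity), ← ENNReal.ofReal_mul (by positivity)]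
  apply ENNReal.ofReal_le_ofReal
  rw [← Real.mul_rpow (by positivity) (by positivity),
    ← Real.mul_rpow (by positivity) (by positivity)]
  apply Real.rpow_le_rpow (by positivity) _ (by positivity)
  have h : ‖x‖ ≤ ‖y‖ + ‖x - y‖ := by
    simpa using norm_add_le y (x - y)
  have h3 := pow_le_pow_left₀ (norm_nonneg x) h 2
  nlinarith [sq_nonneg (‖y‖ - ‖x - y‖), mul_nonneg (sq_nonneg ‖y‖) (sq_nonneg ‖x - y‖)]

lemma wNorm_conv_le {n : ℕ} (p : ℝ≥0∞) (hp : 1 ≤ p) (a : ℝ) (ha : 0 ≤ a) (k : Eu n → ℝ≥0∞)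
    (hk : Measurable k) (F g : Eu n → ℂ) (hg : Measurable g)
    (h : ∀ x, (‖F x‖₊ : ℝ≥0∞) ≤ ∫⁻ y, k y * (‖g (x - y)‖₊ : ℝ≥0∞)) :
    wNorm p a F ≤ ENNReal.ofReal (2 ^ (a / 2)) * (∫⁻ y, k y * jweight a y) * wNorm p a g := by
  have hA : 1 ≤ ENNReal.ofReal ((2:ℝ) ^ (a / 2)) := by
    rw [ENNReal.one_le_ofReal]
    exact Real.one_le_rpow (by norm_num) (by positivity)
  have hkI : ∫⁻ y, k y ≤ ∫⁻ y, k y * jweight a y :=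
    lintegral_mono fun y => le_mul_of_one_le_right' (one_le_jweight a ha y)
  unfold wNorm
  split_ifs with hpt
  · refine essSup_le_of_ae_le _ (Filter.Eventually.of_forall fun x => ?_)
    refine (h x).trans ?_
    set M := essSup (fun x => (‖g x‖₊ : ℝ≥0∞)) volume with hM
    have hae : ∀ᵐ y, (‖g (x - y)‖₊ : ℝ≥0∞) ≤ M :=
      (quasiMeasurePreserving_sub_left volume x).ae (ENNReal.ae_le_essSup _)
    calc _ ≤ ∫⁻ y, k y * M := by
          apply lintegral_mono_ae
          filter_upwards [hae] with y hy
          gcongr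
      _ = (∫⁻ y, k y) * M := lintegral_mul_const _ hk
      _ ≤ _ := by
          exact mul_le_mul' (hkI.trans (le_mul_of_one_le_left' hA)) le_rfl
  · have hr : 1 ≤ p.toReal := by
      rw [← ENNReal.toReal_one]
      exact ENNReal.toReal_mono hpt hp
    have hr0 : 0 < p.toReal := by linarith
    have hy := young_aux k (fun x => (‖g x‖₊ : ℝ≥0∞)) (jweight a) hk (by fun_prop)
      (jweight_measurable a) _ (one_le_jweight a ha) (jweight_le a ha) p.toReal hr
    have h1 : ∫⁻ x, (‖F x‖₊ : ℝ≥0∞) ^ p.toReal * jweight a x ≤ _ :=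
      (lintegral_mono fun x => by gcongr; exact h x).trans hy
    refine (ENNReal.rpow_le_rpow h1 (by positivity : 0 ≤ 1 / p.toReal)).trans ?_
    rw [ENNReal.mul_rpow_of_nonneg _ _ (by positivity),
      ENNReal.mul_rpow_of_nonneg _ _ (by positivity), ← ENNReal.rpow_mul]
    have : p.toReal * (1 / p.toReal) = 1 := by field_simp
    rw [this, ENNReal.rpow_one]
    gcongr
    calc _ ≤ ENNReal.ofReal ((2:ℝ) ^ (a / 2)) ^ (1 : ℝ) := by
          apply ENNReal.rpow_le_rpow_of_exponent_le hA
          rw [div_le_one hr0]; exact hr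
      _ = _ := by simp

lemma fourierInv_mult {n : ℕ} (m : Eu n → ℂ) (f : Eu n → ℂ) (x : Eu n) :
    ((((2 * Real.pi) ^ n)⁻¹ : ℝ) : ℂ) *
      ∫ ξ, m ξ * FT f ξ * Complex.exp (Complex.I * ((⟪x, ξ⟫ : ℝ) : ℂ)) =
    𝓕⁻ (fun η => m ((2 * π) • η) * 𝓕 f η) x := by
  have hFT : ∀ η, FT f ((2 * π) • η) = 𝓕 f η := by
    intro η
    rw [Real.fourier_eq', FT]
    congr 1; funext v
    rw [smul_eq_mul, mul_comm, inner_smul_right]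
    congr 2
    push_cast; ring
  rw [Real.fourierInv_eq']
  have h := Measure.integral_comp_smul_of_nonneg (volume : Measure (Eu n))
    (fun ξ => m ξ * FT f ξ * Complex.exp (Complex.I * ((⟪x, ξ⟫ : ℝ) : ℂ))) (2 * π)
    (hR := by positivity)
  rw [finrank_euclideanSpace_fin, Complex.real_smul] at h
  rw [← h]
  congr 1; funext v
  rw [hFT, smul_eq_mul, mul_comm, inner_smul_right, real_inner_comm]
  congr 2
  push_cast; ring

lemma exists_kernel {n : ℕ} (s a : ℝ) (ha : 0 ≤ a) (ψ : Eu n → ℝ) (hψ : ContDiff ℝ ∞ ψ)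
    (h0 : ∀ ξ, ‖ξ‖ ≤ 1 / 2 → ψ ξ = 0) (h2 : ∀ ξ, 2 ≤ ‖ξ‖ → ψ ξ = 0) :
    ∃ C : ℝ, 0 ≤ C ∧ ∀ j : ℕ, ∃ κ : 𝓢(Eu n, ℂ),
      (∀ η, κ η = ((ψ ((2 : ℝ) ^ (-(j : ℤ)) • (2 * π) • η) *
        (1 + ‖(2 * π) • η‖ ^ 2) ^ (-s / 2) : ℝ) : ℂ)) ∧
      ∫⁻ x, (‖(𝓕⁻ κ) x‖₊ : ℝ≥0∞) * jweight a x ≤ ENNReal.ofReal (C * 2 ^ (-(j : ℝ) * s)) := by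
  obtain ⟨N, hN⟩ := exists_nat_gt (n + a : ℝ)
  obtain ⟨C, hC, hCt⟩ := exists_h s N ψ hψ h0 h2
  have hint : Integrable (fun x : Eu n => C * (1 + ‖x‖) ^ (-((N : ℝ) - a))) :=
    (integrable_one_add_norm (by rw [finrank_euclideanSpace_fin]; linarith)).const_mul C
  refine ⟨∫ x : Eu n, C * (1 + ‖x‖) ^ (-((N : ℝ) - a)),
    integral_nonneg fun x => by positivity, fun j => ?_⟩
  set t : ℝ := (2 : ℝ) ^ (-(j : ℤ)) with ht
  have ht0 : 0 < t := by positivity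
  have ht1 : t ≤ 1 := zpow_le_one_of_nonpos₀ (by norm_num) (by simp)
  obtain ⟨h, hh, hb⟩ := hCt t ht0.le ht1
  have hts : t ^ s = 2 ^ (-(j : ℝ) * s) := by
    rw [ht, ← Real.rpow_intCast, ← Real.rpow_mul (by norm_num)]
    push_cast; rfl
  let e : Eu n ≃L[ℝ] Eu n := ContinuousLinearEquiv.smulLeft (Units.mk0 t ht0.ne')
  let κ : 𝓢(Eu n, ℂ) := ((t ^ s : ℝ) : ℂ) • SchwartzMap.compCLMOfContinuousLinearEquiv ℂ e h
  have hκ : ∀ η, κ η = ((t ^ s : ℝ) : ℂ) * h (t • η) := fun η => rfl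
  refine ⟨κ, ?_, ?_⟩
  · intro η
    rw [hκ, hh, ← Complex.ofReal_mul, smul_comm (2 * π) t η]
    congr 1
    have e1 : t ^ 2 + ‖t • (2 * π) • η‖ ^ 2 = t ^ 2 * (1 + ‖(2 * π) • η‖ ^ 2) := by
      rw [norm_smul t, Real.norm_of_nonneg ht0.le]; ring
    rw [e1, Real.mul_rpow (by positivity) (by positivity), ← Real.rpow_natCast t 2,
      ← Real.rpow_mul ht0.le]
    have e2 : t ^ s * t ^ (((2 : ℕ) : ℝ) * (-s / 2)) = 1 := by
      rw [← Real.rpow_add ht0]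
      have : s + ((2 : ℕ) : ℝ) * (-s / 2) = 0 := by push_cast; ring
      rw [this, Real.rpow_zero]
    linear_combination (ψ (t • (2 * π) • η) * (1 + ‖(2 * π) • η‖ ^ 2) ^ (-s / 2)) * e2
  · have hK : ∀ x, (𝓕⁻ κ) x = (((t ^ s) * (t ^ n)⁻¹ : ℝ) : ℂ) * (𝓕⁻ h) (t⁻¹ • x) := by
      intro x
      rw [SchwartzMap.fourierInv_coe, SchwartzMap.fourierInv_coe, Real.fourierInv_eq',
        Real.fourierInv_eq']
      have hi := Measure.integral_comp_smul_of_nonneg (volume : Measure (Eu n))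
        (fun v => Complex.exp ((↑(2 * π * ⟪v, t⁻¹ • x⟫) * Complex.I)) • h v) t (hR := ht0.le)
      rw [finrank_euclideanSpace_fin, Complex.real_smul] at hi
      rw [Complex.ofReal_mul, mul_assoc, ← hi, ← integral_const_mul]
      congr 1; funext v
      rw [hκ, inner_smul_left, inner_smul_right]
      simp only [smul_eq_mul, conj_trivial]
      rw [mul_inv_cancel_left₀ ht0.ne']
      ring
    have hbound : ∀ x, (‖(𝓕⁻ h) x‖₊ : ℝ≥0∞) * jweight a x ≤
        ENNReal.ofReal (C * (1 + ‖x‖) ^ (-((N : ℝ) - a))) := by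
      intro x
      have hx : 0 < 1 + ‖x‖ := by positivity
      have e1 : (‖(𝓕⁻ h) x‖₊ : ℝ≥0∞) = ENNReal.ofReal ‖(𝓕⁻ h) x‖ := by
        rw [ofReal_norm]; rfl
      rw [e1, jweight, ← ENNReal.ofReal_mul (norm_nonneg _)]
      apply ENNReal.ofReal_le_ofReal
      have e2 : (1 + ‖x‖ ^ 2) ^ (a / 2) ≤ (1 + ‖x‖) ^ a := by
        have : (1 + ‖x‖) ^ a = ((1 + ‖x‖) ^ (2:ℝ)) ^ (a / 2) := by
          rw [← Real.rpow_mul hx.le]; congr 1; ring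
        rw [this]
        apply Real.rpow_le_rpow (by positivity) _ (by positivity)
        rw [Real.rpow_two]
        nlinarith [norm_nonneg x]
      have e3 : (1 + ‖x‖) ^ (-((N : ℝ) - a)) = ((1 + ‖x‖) ^ N)⁻¹ * (1 + ‖x‖) ^ a := by
        rw [neg_sub, sub_eq_neg_add, Real.rpow_add hx, Real.rpow_neg hx.le, Real.rpow_natCast]
      have e4 : ‖(𝓕⁻ h) x‖ ≤ C * ((1 + ‖x‖) ^ N)⁻¹ := by
        rw [← div_eq_mul_inv, le_div_iff₀ (by positivity), mul_comm]
        exact hb x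
      rw [e3, ← mul_assoc]
      gcongr
    have hscale : ∀ g : Eu n → ℝ≥0∞, Measurable g →
        ∫⁻ x, g (t⁻¹ • x) = ENNReal.ofReal (t ^ n) * ∫⁻ x, g x := by
      intro g hg
      have hm : Measurable (fun x : Eu n => t⁻¹ • x) := by fun_prop
      rw [← lintegral_map hg hm, Measure.map_addHaar_smul _ (inv_ne_zero ht0.ne'),
        lintegral_smul_measure, finrank_euclideanSpace_fin, smul_eq_mul]
      congr 2
      rw [inv_pow, inv_inv, abs_of_pos (by positivity)]
    have hmw := jweight_measurable (n := n) a
    have hmh : Measurable (fun x => (𝓕⁻ h) x) := (𝓕⁻ h).continuous.measurable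
    have hmm : Measurable (fun x => (‖(𝓕⁻ h) x‖₊ : ℝ≥0∞) * jweight a x) := by fun_prop
    have hsc := hscale _ hmm
    calc _ ≤ ∫⁻ x, ENNReal.ofReal (t ^ s * (t ^ n)⁻¹) *
          ((‖(𝓕⁻ h) (t⁻¹ • x)‖₊ : ℝ≥0∞) * jweight a (t⁻¹ • x)) := by
          refine lintegral_mono fun x => ?_
          simp only
          rw [hK, nnnorm_mul, ENNReal.coe_mul, mul_assoc]
          have e1 : (‖(((t ^ s) * (t ^ n)⁻¹ : ℝ) : ℂ)‖₊ : ℝ≥0∞) =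
              ENNReal.ofReal (t ^ s * (t ^ n)⁻¹) := by
            rw [← enorm_eq_nnnorm, ← ofReal_norm, Complex.norm_real,
              Real.norm_of_nonneg (by positivity)]
          rw [e1]
          gcongr
          unfold jweight
          apply ENNReal.ofReal_le_ofReal
          apply Real.rpow_le_rpow (by positivity) _ (by positivity)
          gcongr
          rw [norm_smul, Real.norm_of_nonneg (by positivity)]
          exact le_mul_of_one_le_left (norm_nonneg _) ((one_le_inv₀ ht0).2 ht1)
      _ = ENNReal.ofReal (t ^ s * (t ^ n)⁻¹) * (ENNReal.ofReal (t ^ n) *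
          ∫⁻ x, (‖(𝓕⁻ h) x‖₊ : ℝ≥0∞) * jweight a x) := by
          rw [lintegral_const_mul _ (by fun_prop)]
          exact congrArg _ hsc
      _ = ENNReal.ofReal (t ^ s) * ∫⁻ x, (‖(𝓕⁻ h) x‖₊ : ℝ≥0∞) * jweight a x := by
          rw [← mul_assoc, ← ENNReal.ofReal_mul (by positivity)]
          congr 2
          field_simp
      _ ≤ ENNReal.ofReal (t ^ s) *
          ∫⁻ x : Eu n, ENNReal.ofReal (C * (1 + ‖x‖) ^ (-((N : ℝ) - a))) := by
          gcongr with x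
          exact hbound x
      _ = _ := by
          rw [← ofReal_integral_eq_lintegral_ofReal hint
            (Filter.Eventually.of_forall fun x => by positivity),
            ← ENNReal.ofReal_mul (by positivity), hts, mul_comm]

lemma SProj_props {n : ℕ} (s a : ℝ) (hs : 0 < s) (ha : 0 ≤ a) (Φ : Eu n → ℝ) (hΦ : IsLPBump Φ) :
    ∃ (C : ℝ) (K : ℕ → Eu n → ℂ), 0 ≤ C ∧ (∀ j, Measurable (K j)) ∧
      (∀ j, ∫⁻ x, (‖K j x‖₊ : ℝ≥0∞) * jweight a x ≤ ENNReal.ofReal (C * 2 ^ (-(j : ℝ) * s))) ∧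
      ∀ f : 𝓢(Eu n, ℂ), Measurable (Js s ⇑f) ∧
        (∀ x, Filter.Tendsto (fun j : ℕ => SProj Φ (j : ℤ) ⇑f x) Filter.atTop (nhds (f x))) ∧
        ∀ (j : ℕ) x, SProj Φ ((j + 1 : ℕ) : ℤ) ⇑f x - SProj Φ (j : ℤ) ⇑f x =
          ∫ y, K (j + 1) y * Js s ⇑f (x - y) := by
  obtain ⟨hsm, h01, hone, hzero⟩ := hΦ
  let ψ : Eu n → ℝ := fun ξ => Φ ξ - Φ ((2 : ℝ) • ξ)
  have hψ : ContDiff ℝ ∞ ψ := hsm.sub (hsm.comp (contDiff_const_smul 2))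
  have hn2 : ∀ ξ : Eu n, ‖(2 : ℝ) • ξ‖ = 2 * ‖ξ‖ := fun ξ => by
    rw [norm_smul, Real.norm_of_nonneg (by norm_num)]
  obtain ⟨C, hC, hκ⟩ := exists_kernel s a ha ψ hψ
    (fun ξ h => by
      simp only [ψ]
      rw [hone ξ (by linarith), hone _ (by rw [hn2]; linarith), sub_self])
    (fun ξ h => by
      simp only [ψ]
      rw [hzero ξ h, hzero _ (by rw [hn2]; linarith), sub_self])
  choose κ hκ1 hκ2 using hκ
  refine ⟨C, fun j x => (𝓕⁻ (κ j)) x, hC, fun j => (𝓕⁻ (κ j)).continuous.measurable, hκ2, ?_⟩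
  intro f
  -- multipliers
  have hlin : (fun η : Eu n => (2 * π) • η).HasTemperateGrowth :=
    ((2 * π) • ContinuousLinearMap.id ℝ (Eu n)).hasTemperateGrowth
  have hbt : (fun η : Eu n => (((1 + ‖(2 * π) • η‖ ^ 2) ^ (s / 2) : ℝ) : ℂ)).HasTemperateGrowth :=
    Function.Complex.hasTemperateGrowth_ofReal.comp
      ((Function.hasTemperateGrowth_one_add_norm_sq_rpow (Eu n) (s / 2)).comp hlin)
  have hΦt : Φ.HasTemperateGrowth :=
    HasCompactSupport.hasTemperateGrowth (HasCompactSupport.intro (isCompact_closedBall 0 2)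
      (fun x hx => hzero x (by simp at hx; exact hx.le))) hsm
  have hφt : ∀ j : ℕ, (fun η : Eu n =>
      ((Φ ((2 : ℝ) ^ (-(j : ℤ)) • (2 * π) • η) : ℝ) : ℂ)).HasTemperateGrowth := by
    intro j
    have : (fun η : Eu n => (2 : ℝ) ^ (-(j : ℤ)) • (2 * π) • η).HasTemperateGrowth :=
      ((2 : ℝ) ^ (-(j : ℤ)) • (2 * π) • ContinuousLinearMap.id ℝ (Eu n)).hasTemperateGrowth
    exact Function.Complex.hasTemperateGrowth_ofReal.comp (hΦt.comp this)
  let G : 𝓢(Eu n, ℂ) := SchwartzMap.smulLeftCLM ℂ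
    (fun η : Eu n => (((1 + ‖(2 * π) • η‖ ^ 2) ^ (s / 2) : ℝ) : ℂ)) (𝓕 f)
  have hG : ∀ η, G η = (((1 + ‖(2 * π) • η‖ ^ 2) ^ (s / 2) : ℝ) : ℂ) * (𝓕 f) η := fun η =>
    SchwartzMap.smulLeftCLM_apply_apply hbt _ η
  let P : ℕ → 𝓢(Eu n, ℂ) := fun j => SchwartzMap.smulLeftCLM ℂ
    (fun η : Eu n => ((Φ ((2 : ℝ) ^ (-(j : ℤ)) • (2 * π) • η) : ℝ) : ℂ)) (𝓕 f)
  have hP : ∀ j η, P j η = ((Φ ((2 : ℝ) ^ (-(j : ℤ)) • (2 * π) • η) : ℝ) : ℂ) * (𝓕 f) η :=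
    fun j η => SchwartzMap.smulLeftCLM_apply_apply (hφt j) _ η
  have hJ : Js s ⇑f = fun x => (𝓕⁻ G) x := by
    funext x
    rw [Js, fourierInv_mult (fun ξ => (((1 + ‖ξ‖ ^ 2) ^ (s / 2) : ℝ) : ℂ)),
      SchwartzMap.fourierInv_coe]
    have e : (fun η => (((1 + ‖(2 * π) • η‖ ^ 2) ^ (s / 2) : ℝ) : ℂ) * 𝓕 (⇑f) η) = ⇑G := by
      funext η
      rw [hG, SchwartzMap.fourier_coe]
    exact congrArg (fun u : Eu n → ℂ => 𝓕⁻ u x) e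
  have hS : ∀ j : ℕ, SProj Φ (j : ℤ) ⇑f = fun x => (𝓕⁻ (P j)) x := by
    intro j
    funext x
    rw [SProj, fourierInv_mult (fun ξ => ((Φ ((2 : ℝ) ^ (-(j : ℤ)) • ξ) : ℝ) : ℂ)),
      SchwartzMap.fourierInv_coe]
    have e : (fun η => ((Φ ((2 : ℝ) ^ (-(j : ℤ)) • (2 * π) • η) : ℝ) : ℂ) * 𝓕 (⇑f) η) = ⇑(P j) := by
      funext η
      rw [hP, SchwartzMap.fourier_coe]
    exact congrArg (fun u : Eu n → ℂ => 𝓕⁻ u x) e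
  refine ⟨?_, ?_, ?_⟩
  · rw [hJ]; exact (𝓕⁻ G).continuous.measurable
  · intro x
    have hf : f x = (𝓕⁻ (𝓕 f)) x := by simp
    rw [hf]
    simp only [hS]
    simp only [SchwartzMap.fourierInv_coe, Real.fourierInv_eq']
    refine tendsto_integral_of_dominated_convergence (fun η => ‖(𝓕 f) η‖) ?_ ?_ ?_ ?_
    · intro j
      refine Continuous.aestronglyMeasurable ?_
      have := (P j).continuous
      fun_prop
    · exact (𝓕 f).integrable.norm
    · intro j
      refine Filter.Eventually.of_forall fun η => ?_
      rw [norm_smul, Complex.norm_exp_ofReal_mul_I, one_mul, hP, norm_mul, Complex.norm_real,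
        Real.norm_of_nonneg (h01 _).1]
      exact mul_le_of_le_one_left (norm_nonneg _) (h01 _).2
    · refine Filter.Eventually.of_forall fun η => ?_
      refine Filter.Tendsto.const_smul ?_ _
      simp only [hP]
      have h1 : Filter.Tendsto (fun j : ℕ => (2 : ℝ) ^ (-(j : ℤ)) • (2 * π) • η) Filter.atTop
          (nhds ((0 : ℝ) • (2 * π) • η)) := by
        refine Filter.Tendsto.smul_const ?_ _
        have := tendsto_pow_atTop_nhds_zero_of_lt_one (r := (1 / 2 : ℝ)) (by norm_num)
          (by norm_num)
        refine this.congr fun j => ?_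
        rw [zpow_neg, zpow_natCast, one_div, inv_pow]
      have h2 := (hsm.continuous.tendsto _).comp h1
      rw [zero_smul, hone 0 (by simp)] at h2
      have h3 := ((Complex.continuous_ofReal.tendsto _).comp h2).mul_const ((𝓕 f) η)
      simpa [Function.comp_def] using h3
  · intro j x
    have hpair : P (j + 1) - P j =
        SchwartzMap.pairing (ContinuousLinearMap.mul ℂ ℂ) (κ (j + 1)) G := by
      ext η
      rw [SchwartzMap.pairing_apply_apply, ContinuousLinearMap.mul_apply', hκ1, hG]
      change P (j + 1) η - P j η = _
      rw [hP, hP]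
      have e1 : (2 : ℝ) • (2 : ℝ) ^ (-((j + 1 : ℕ) : ℤ)) • (2 * π) • η =
          (2 : ℝ) ^ (-(j : ℤ)) • (2 * π) • η := by
        rw [smul_smul]
        congr 1
        rw [zpow_neg, zpow_neg, zpow_natCast, zpow_natCast, pow_succ]
        field_simp
      have e2 : (1 + ‖(2 * π) • η‖ ^ 2) ^ (-s / 2) * (1 + ‖(2 * π) • η‖ ^ 2) ^ (s / 2) = 1 := by
        rw [← Real.rpow_add (by positivity)]
        have : -s / 2 + s / 2 = 0 := by ring
        rw [this, Real.rpow_zero]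
      simp only [ψ, e1]
      have e3 := congrArg (fun r : ℝ => (r : ℂ)) e2
      simp only [Complex.ofReal_mul, Complex.ofReal_one] at e3
      simp only [Complex.ofReal_mul, Complex.ofReal_sub]
      linear_combination -((Φ ((2 : ℝ) ^ (-((j + 1 : ℕ) : ℤ)) • (2 * π) • η) : ℂ) -
        (Φ ((2 : ℝ) ^ (-(j : ℤ)) • (2 * π) • η) : ℂ)) * (𝓕 f) η * e3
    have hconv : SchwartzMap.convolution (ContinuousLinearMap.mul ℂ ℂ) (𝓕⁻ (κ (j + 1))) (𝓕⁻ G) =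
        𝓕⁻ (P (j + 1)) - 𝓕⁻ (P j) := by
      have : 𝓕⁻ (P (j + 1)) - 𝓕⁻ (P j) = 𝓕⁻ (P (j + 1) - P j) :=
        (map_sub (FourierTransform.fourierInvCLM ℂ 𝓢(Eu n, ℂ)) _ _).symm
      rw [this, hpair]
      simp [SchwartzMap.convolution]
    rw [hS, hS, hJ]
    have h1 : (𝓕⁻ (P (j + 1)) - 𝓕⁻ (P j)) x = 𝓕⁻ (P (j + 1)) x - 𝓕⁻ (P j) x := rfl
    rw [← h1, ← hconv, SchwartzMap.convolution_apply]
    rfl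

/-- **Weighted Bernstein inequality, high-frequency part** (Lemma 3.3 (i)). -/
theorem weighted_bernstein_high (n : ℕ) (hn : 1 ≤ n) (s : ℝ) (hs : 0 < s)
    (p : ℝ≥0∞) (hp : 1 ≤ p) (a : ℝ) (ha : 0 ≤ a)
    (Φ : Eu n → ℝ) (hΦ : IsLPBump Φ) :
    ∃ C : ℝ, 0 < C ∧ ∀ k : ℕ, ∀ f : SchwartzMap (Eu n) ℂ,
      wNorm p a (fun x => f x - SProj Φ (k : ℤ) ⇑f x) ≤
        ENNReal.ofReal (C * 2 ^ (-(k : ℝ) * s)) * wNorm p a (Js s ⇑f) := by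
  obtain ⟨C, K, hC, hKm, hK, hf⟩ := SProj_props s a hs ha Φ hΦ
  set q : ℝ := 2 ^ (-s) with hq
  have hq0 : 0 < q := by positivity
  have hq1 : q < 1 := Real.rpow_lt_one_of_one_lt_of_neg (by norm_num) (by linarith)
  have hpow : ∀ j : ℕ, (2 : ℝ) ^ (-(j : ℝ) * s) = q ^ j := by
    intro j
    rw [hq, ← Real.rpow_natCast, ← Real.rpow_mul (by norm_num)]
    congr 1; ring
  refine ⟨2 ^ (a / 2) * (C * (q * (1 - q)⁻¹)) + 1, ?_, ?_⟩
  · have : 0 ≤ (1 - q)⁻¹ := inv_nonneg.2 (by linarith)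
    positivity
  intro k f
  obtain ⟨hJm, hlim, hdiff⟩ := hf f
  let kk : Eu n → ℝ≥0∞ := fun y => ∑' j : ℕ, (‖K (k + j + 1) y‖₊ : ℝ≥0∞)
  have hkk : Measurable kk := Measurable.ennreal_tsum fun j => by
    have := hKm (k + j + 1)
    fun_prop
  have hpt : ∀ x, (‖f x - SProj Φ (k : ℤ) ⇑f x‖₊ : ℝ≥0∞) ≤
      ∫⁻ y, kk y * (‖Js s ⇑f (x - y)‖₊ : ℝ≥0∞) := by
    intro x
    have hl : Filter.Tendsto (fun j : ℕ => SProj Φ ((k + j : ℕ) : ℤ) ⇑f x) Filter.atTop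
        (nhds (f x)) := by
      have := (hlim x).comp (Filter.tendsto_add_atTop_nat k)
      refine this.congr fun j => ?_
      simp only [Function.comp, add_comm]
    have h1 := edist_le_tsum_of_edist_le_of_tendsto₀
      (f := fun j : ℕ => SProj Φ ((k + j : ℕ) : ℤ) ⇑f x)
      (fun j => ∫⁻ y, (‖K (k + j + 1) y‖₊ : ℝ≥0∞) * (‖Js s ⇑f (x - y)‖₊ : ℝ≥0∞)) (fun j => ?_) hl
    · have e1 : (‖f x - SProj Φ (k : ℤ) ⇑f x‖₊ : ℝ≥0∞) =
          edist (SProj Φ ((k + 0 : ℕ) : ℤ) ⇑f x) (f x) := by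
        rw [edist_comm, edist_eq_enorm_sub]; rfl
      rw [e1]
      refine h1.trans (le_of_eq ?_)
      rw [← lintegral_tsum]
      · simp only [kk, ENNReal.tsum_mul_right]
      · intro j
        have := hKm (k + j + 1)
        fun_prop
    · have h2 := hdiff (k + j) x
      rw [edist_comm, edist_eq_enorm_sub]
      have e2 : k + j.succ = k + j + 1 := rfl
      rw [e2, h2]
      refine (enorm_integral_le_lintegral_enorm _).trans (le_of_eq ?_)
      refine lintegral_congr fun y => ?_
      rw [enorm_mul]; rfl
  have hmain := wNorm_conv_le p hp a ha kk hkk _ _ hJm hpt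
  refine hmain.trans ?_
  gcongr
  have hI : ∫⁻ y, kk y * jweight a y ≤ ENNReal.ofReal (C * (q * (1 - q)⁻¹) * q ^ k) := by
    have hw := jweight_measurable (n := n) a
    simp only [kk, ← ENNReal.tsum_mul_right]
    rw [lintegral_tsum (fun j => by
      have := hKm (k + j + 1)
      fun_prop)]
    have hsum : HasSum (fun j : ℕ => C * q ^ (k + j + 1)) (C * (q * (1 - q)⁻¹) * q ^ k) := by
      have := (hasSum_geometric_of_lt_one hq0.le hq1).mul_left (C * q * q ^ k)
      have e1 : (fun j : ℕ => C * q ^ (k + j + 1)) = fun j => C * q * q ^ k * q ^ j := by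
        funext j; ring
      have e2 : C * (q * (1 - q)⁻¹) * q ^ k = C * q * q ^ k * (1 - q)⁻¹ := by ring
      rw [e1, e2]; exact this
    calc _ ≤ ∑' j : ℕ, ENNReal.ofReal (C * q ^ (k + j + 1)) := by
          refine ENNReal.tsum_le_tsum fun j => ?_
          rw [← hpow]
          exact hK _
      _ = _ := by
          rw [← ENNReal.ofReal_tsum_of_nonneg (fun j => by positivity) hsum.summable,
            hsum.tsum_eq]
  calc _ ≤ ENNReal.ofReal (2 ^ (a / 2)) * ENNReal.ofReal (C * (q * (1 - q)⁻¹) * q ^ k) := by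
        gcongr
    _ = ENNReal.ofReal (2 ^ (a / 2) * (C * (q * (1 - q)⁻¹) * q ^ k)) := by
        rw [← ENNReal.ofReal_mul (by positivity)]
    _ ≤ _ := by
        apply ENNReal.ofReal_le_ofReal
        rw [hpow]
        have : 0 ≤ q ^ k := by positivity
        nlinarith
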